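/- For any spray G on a nonempty open set U ⊆ ℝ^n (n ≥ 2), the divergence of the Weyl curvature satisfies W^m_{k|m} = (n−2) ( R_{|k} − ½ R_{·k|m} y^m − (1/(n+1)) χ_{k|m} y^m ) on U × (ℝ^n \ {0}), where R is the Ricci scalar, χ_k the χ-curvature, W^i_k the Weyl curvature, and '|' the horizontal covariant derivative with respect to G. -/

import Mathlib

open scoped BigOperators
open MeasureTheory

noncomputable section BerwaldWeyl

/-- Points/vectors in local coordinates on `ℝⁿ`. -/
abbrev Vec (n : ℕ) := Fin n → ℝ

/-- Partial derivative in the base (`x`) variable along the `i`-th coordinate. -/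
def pdx {n : ℕ} (f : Vec n → Vec n → ℝ) (i : Fin n) : Vec n → Vec n → ℝ :=
  fun x y => fderiv ℝ (fun x' => f x' y) x (Pi.single i 1)

/-- Vertical derivative `f_{·i} = ∂f/∂y^i`. -/
def pdy {n : ℕ} (f : Vec n → Vec n → ℝ) (i : Fin n) : Vec n → Vec n → ℝ :=
  fun x y => fderiv ℝ (fun y' => f x y') y (Pi.single i 1)

/-- The slit fiber `ℝⁿ \ {0}`. -/
def slit (n : ℕ) : Set (Vec n) := {y | y ≠ 0}

/-- A spray on `U ⊆ ℝⁿ`: a family `G^i(x,y)`, smooth on `U × (ℝⁿ \ {0})` and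
positively 2-homogeneous in `y`. -/
def IsSpray {n : ℕ} (U : Set (Vec n)) (G : Fin n → Vec n → Vec n → ℝ) : Prop :=
  (∀ i, ContDiffOn ℝ (⊤ : ℕ∞) (fun p : Vec n × Vec n => G i p.1 p.2) (U ×ˢ slit n)) ∧
  (∀ i, ∀ x ∈ U, ∀ y ∈ slit n, ∀ c : ℝ, 0 < c → G i x (c • y) = c ^ 2 * G i x y)

/-- Nonlinear connection coefficients `N^i_j := ∂G^i/∂y^j`. -/
def Nc {n : ℕ} (G : Fin n → Vec n → Vec n → ℝ) (i j : Fin n) : Vec n → Vec n → ℝ :=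
  pdy (G i) j

/-- Berwald connection coefficients `Γ^i_{jk} := ∂²G^i/∂y^j∂y^k`. -/
def Γc {n : ℕ} (G : Fin n → Vec n → Vec n → ℝ) (i j k : Fin n) : Vec n → Vec n → ℝ :=
  pdy (pdy (G i) j) k

/-- Horizontal derivative of a scalar: `f_{|k} := δf/δx^k = ∂f/∂x^k - N^l_k ∂f/∂y^l`. -/
def hD {n : ℕ} (G : Fin n → Vec n → Vec n → ℝ) (f : Vec n → Vec n → ℝ) (k : Fin n) :
    Vec n → Vec n → ℝ :=
  fun x y => pdx f k x y - ∑ l, Nc G l k x y * pdy f l x y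

/-- Horizontal covariant derivative `A_{j|m}` of a 1-form `A_j`. -/
def covD1 {n : ℕ} (G : Fin n → Vec n → Vec n → ℝ) (A : Fin n → Vec n → Vec n → ℝ)
    (j m : Fin n) : Vec n → Vec n → ℝ :=
  fun x y => hD G (A j) m x y - ∑ l, A l x y * Γc G l j m x y

/-- Horizontal covariant derivative `A^i_{j|m}` of a (1,1)-tensor `A^i_j`. -/
def covD11 {n : ℕ} (G : Fin n → Vec n → Vec n → ℝ)
    (A : Fin n → Fin n → Vec n → Vec n → ℝ) (i j m : Fin n) : Vec n → Vec n → ℝ :=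
  fun x y => hD G (A i j) m x y + ∑ l, A l j x y * Γc G i l m x y
    - ∑ l, A i l x y * Γc G l j m x y

/-- Horizontal covariant derivative `B^i_{jk|m}` of a (1,2)-tensor `B^i_{jk}`. -/
def covD12 {n : ℕ} (G : Fin n → Vec n → Vec n → ℝ)
    (B : Fin n → Fin n → Fin n → Vec n → Vec n → ℝ) (i j k m : Fin n) : Vec n → Vec n → ℝ :=
  fun x y => hD G (B i j k) m x y + ∑ l, B l j k x y * Γc G i l m x y
    - ∑ l, B i l k x y * Γc G l j m x y - ∑ l, B i j l x y * Γc G l k m x y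

/-- Riemann curvature `R^i_k`. -/
def Riem {n : ℕ} (G : Fin n → Vec n → Vec n → ℝ) (i k : Fin n) : Vec n → Vec n → ℝ :=
  fun x y => 2 * pdx (G i) k x y - ∑ j, y j * pdy (pdx (G i) j) k x y
    + 2 * ∑ j, G j x y * Γc G i j k x y - ∑ s, Nc G i s x y * Nc G s k x y

/-- Ricci scalar `R := R^m_m/(n-1)`. -/
def Ricci {n : ℕ} (G : Fin n → Vec n → Vec n → ℝ) : Vec n → Vec n → ℝ :=
  fun x y => (∑ m, Riem G m m x y) / ((n : ℝ) - 1)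

/-- The Weyl-type curvature `T^i_k := R^i_k - (R δ^i_k - ½ R_{·k} y^i)`. -/
def Tcurv {n : ℕ} (G : Fin n → Vec n → Vec n → ℝ) (i k : Fin n) : Vec n → Vec n → ℝ :=
  fun x y => Riem G i k x y -
    (Ricci G x y * (if i = k then 1 else 0) - (1/2) * pdy (Ricci G) k x y * y i)

/-- The χ-curvature `χ_i := -(1/3) T^m_{i·m}`. -/
def chiC {n : ℕ} (G : Fin n → Vec n → Vec n → ℝ) (i : Fin n) : Vec n → Vec n → ℝ :=
  fun x y => -(1/3) * ∑ m, pdy (Tcurv G m i) m x y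

/-- The Weyl curvature `W^i_k := T^i_k + (3χ_k/(n+1)) y^i`. -/
def Weyl {n : ℕ} (G : Fin n → Vec n → Vec n → ℝ) (i k : Fin n) : Vec n → Vec n → ℝ :=
  fun x y => Tcurv G i k x y + (3 * chiC G k x y / ((n : ℝ) + 1)) * y i

/-- A volume form `dV = σ(x) dx` on `U`: `σ` smooth and positive. -/
def IsVolumeForm {n : ℕ} (U : Set (Vec n)) (σ : Vec n → ℝ) : Prop :=
  ContDiffOn ℝ (⊤ : ℕ∞) σ U ∧ ∀ x ∈ U, 0 < σ x

/-- The S-curvature of `(G, dV)`: `S := ∂G^m/∂y^m - y^m ∂(ln σ)/∂x^m`. -/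
def Scurv {n : ℕ} (G : Fin n → Vec n → Vec n → ℝ) (σ : Vec n → ℝ) : Vec n → Vec n → ℝ :=
  fun x y => ∑ m, Nc G m m x y
    - ∑ m, y m * fderiv ℝ (fun x' => Real.log (σ x')) x (Pi.single m 1)

/-- The projective spray `Ĝ^i := G^i - (S/(n+1)) y^i` of `(G, dV)`. -/
def Ghat {n : ℕ} (G : Fin n → Vec n → Vec n → ℝ) (σ : Vec n → ℝ) :
    Fin n → Vec n → Vec n → ℝ :=
  fun i x y => G i x y - (Scurv G σ x y / ((n : ℝ) + 1)) * y i

/-- The Berwald–Weyl curvature `W^o_k := R̂_{∥k} - ½ R̂_{·k∥m} y^m` of `(G, dV)`,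
where all hatted quantities and `∥` are taken with respect to the projective spray `Ĝ`. -/
def BWeyl {n : ℕ} (G : Fin n → Vec n → Vec n → ℝ) (σ : Vec n → ℝ) (k : Fin n) :
    Vec n → Vec n → ℝ :=
  fun x y => hD (Ghat G σ) (Ricci (Ghat G σ)) k x y
    - (1/2) * ∑ m, covD1 (Ghat G σ) (fun j => pdy (Ricci (Ghat G σ)) j) k m x y * y m


/-- A commutative algebra with the coordinate derivations `∂/∂x^i`, `∂/∂y^i`, the fibre coordinates
`y^i` and the coefficients `G^i` of a spray. -/
structure SprayAlgebra (n : ℕ) (A : Type*) [CommRing A] [Algebra ℝ A] where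
  X : Fin n → Derivation ℝ A A
  Y : Fin n → Derivation ℝ A A
  y : Fin n → A
  G : Fin n → A
  X_comm_X : ∀ i j a, X i (X j a) = X j (X i a)
  X_comm_Y : ∀ i j a, X i (Y j a) = Y j (X i a)
  Y_comm_Y : ∀ i j a, Y i (Y j a) = Y j (Y i a)
  X_y : ∀ i j, X i (y j) = 0
  Y_y : ∀ i j, Y i (y j) = if j = i then 1 else 0
  euler_G : ∀ i, ∑ j, y j * Y j (G i) = 2 * G i

namespace SprayAlgebra

variable {n : ℕ} {A : Type*} [CommRing A] [Algebra ℝ A] (S : SprayAlgebra n A)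

/-- Nonlinear connection coefficients. -/
def N (i j : Fin n) : A := S.Y j (S.G i)

/-- Berwald connection coefficients. -/
def Γ (i j k : Fin n) : A := S.Y k (S.Y j (S.G i))

/-- Horizontal derivation `δ/δx^k`. -/
def δ (k : Fin n) : Derivation ℝ A A := S.X k - ∑ l, S.N l k • S.Y l

/-- Curvature `R^i_{kl}` of the nonlinear connection. -/
def K (i k l : Fin n) : A := S.δ k (S.N i l) - S.δ l (S.N i k)

/-- Riemann curvature. -/
def riem (i k : Fin n) : A :=
  2 * S.X k (S.G i) - ∑ j, S.y j * S.Y k (S.X j (S.G i)) + 2 * ∑ j, S.G j * S.Γ i j k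
    - ∑ s, S.N i s * S.N s k

/-- Covariant derivative of a `1`-form. -/
def cov (B : Fin n → A) (k m : Fin n) : A := S.δ m (B k) - ∑ l, B l * S.Γ l k m

/-- Divergence `B^m_{k|m}` of a `(1,1)`-tensor. -/
def div (B : Fin n → Fin n → A) (k : Fin n) : A :=
  ∑ m, (S.δ m (B m k) + ∑ l, B l k * S.Γ m l m - ∑ l, B m l * S.Γ l k m)

lemma Γ_symm (i j k : Fin n) : S.Γ i j k = S.Γ i k j := S.Y_comm_Y _ _ _

lemma δ_apply (k : Fin n) (a : A) : S.δ k a = S.X k a - ∑ l, S.N l k * S.Y l a := by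
  have h : ⇑(∑ l, S.N l k • S.Y l) = ∑ l, ⇑(S.N l k • S.Y l) :=
    map_sum (Derivation.coeFnAddMonoidHom (R := ℝ) (A := A) (M := A)) _ _
  simp [δ, h]

lemma δ_y (k j : Fin n) : S.δ k (S.y j) = - S.N j k := by
  simp [δ_apply, S.X_y, S.Y_y]

lemma sum_y_mul_N (i : Fin n) : ∑ j, S.y j * S.N i j = 2 * S.G i := S.euler_G i

/-- Differentiating Euler's relation for a `(d+1)`-homogeneous element. -/
lemma euler_Y {a c : A} (h : ∑ j, S.y j * S.Y j a = c) (k : Fin n) :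
    ∑ j, S.y j * S.Y j (S.Y k a) = S.Y k c - S.Y k a := by
  rw [← h, map_sum]
  simp only [Derivation.leibniz, S.Y_y, smul_eq_mul, Finset.sum_add_distrib, mul_ite, mul_one,
    mul_zero, Finset.sum_ite_eq', Finset.mem_univ, if_true, S.Y_comm_Y k]
  ring

lemma Y_two_mul (k : Fin n) (a : A) : S.Y k (2 * a) = 2 * S.Y k a := by
  rw [two_mul, map_add, two_mul]

lemma δ_two_mul (k : Fin n) (a : A) : S.δ k (2 * a) = 2 * S.δ k a := by
  rw [two_mul, map_add, two_mul]

lemma euler_N (i k : Fin n) : ∑ j, S.y j * S.Y j (S.N i k) = S.N i k := by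
  have h := S.euler_Y (S.euler_G i) k
  rw [S.Y_two_mul] at h
  rw [N, h]; ring

lemma sum_y_mul_Γ (i k : Fin n) : ∑ j, S.y j * S.Γ i k j = S.N i k := S.euler_N i k

lemma Y_δ (s k : Fin n) (a : A) :
    S.Y s (S.δ k a) = S.δ k (S.Y s a) - ∑ l, S.Γ l k s * S.Y l a := by
  simp only [δ_apply, map_sub, map_sum, Derivation.leibniz, smul_eq_mul, S.X_comm_Y,
    Finset.sum_add_distrib, S.Y_comm_Y s]
  have : ∀ l, S.Y l a * S.Y s (S.N l k) = S.Γ l k s * S.Y l a := fun l => mul_comm _ _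
  simp only [this]
  ring

lemma δ_comm (k l : Fin n) (a : A) :
    S.δ k (S.δ l a) - S.δ l (S.δ k a) = - ∑ m, S.K m k l * S.Y m a := by
  have key : ∀ k l, S.δ k (S.δ l a) = S.X k (S.X l a) - ∑ s, S.N s k * S.Y s (S.X l a)
      - ∑ s, S.N s l * S.Y s (S.X k a) - ∑ s, S.δ k (S.N s l) * S.Y s a
      + ∑ m, ∑ s, S.N m l * S.N s k * S.Y s (S.Y m a) := by
    intro k l
    rw [S.δ_apply l a, map_sub, map_sum, S.δ_apply k (S.X l a)]
    have : ∀ m, S.δ k (S.N m l * S.Y m a) = S.δ k (S.N m l) * S.Y m a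
        + S.N m l * S.Y m (S.X k a) - ∑ s, S.N m l * S.N s k * S.Y s (S.Y m a) := by
      intro m
      rw [Derivation.leibniz, S.δ_apply k (S.Y m a), S.X_comm_Y, smul_eq_mul, smul_eq_mul, mul_sub,
        Finset.mul_sum]
      simp only [mul_assoc]
      ring
    simp only [this, Finset.sum_add_distrib, Finset.sum_sub_distrib]
    ring
  rw [key k l, key l k, S.X_comm_X k l]
  have h : ∑ m, ∑ s, S.N m l * S.N s k * S.Y s (S.Y m a)
      = ∑ m, ∑ s, S.N m k * S.N s l * S.Y s (S.Y m a) := by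
    rw [Finset.sum_comm]
    refine Finset.sum_congr rfl fun i _ => Finset.sum_congr rfl fun j _ => ?_
    rw [S.Y_comm_Y]; ring
  rw [h]
  simp only [K, sub_mul, Finset.sum_sub_distrib]
  ring

lemma K_antisymm (i k l : Fin n) : S.K i k l = - S.K i l k := by simp [K]

lemma riem_eq (i k : Fin n) : S.riem i k = ∑ l, S.K i k l * S.y l := by
  have h1 : ∑ l, S.δ k (S.N i l) * S.y l = 2 * S.X k (S.G i) - ∑ s, S.N i s * S.N s k := by
    have h := congrArg (S.δ k) (S.sum_y_mul_N i)
    rw [map_sum, S.δ_two_mul, S.δ_apply k (S.G i)] at h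
    simp only [Derivation.leibniz, S.δ_y, smul_eq_mul, Finset.sum_add_distrib, mul_neg,
      Finset.sum_neg_distrib] at h
    have e : ∑ l, S.N l k * S.Y l (S.G i) = ∑ s, S.N i s * S.N s k :=
      Finset.sum_congr rfl fun _ _ => mul_comm _ _
    rw [e] at h
    have e' : ∑ l, S.δ k (S.N i l) * S.y l = ∑ l, S.y l * S.δ k (S.N i l) :=
      Finset.sum_congr rfl fun _ _ => mul_comm _ _
    rw [e']
    linear_combination h
  have h2 : ∑ l, S.δ l (S.N i k) * S.y l = ∑ j, S.y j * S.Y k (S.X j (S.G i))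
      - 2 * ∑ j, S.G j * S.Γ i j k := by
    simp only [δ_apply, sub_mul, Finset.sum_sub_distrib, Finset.sum_mul]
    rw [Finset.sum_comm (f := fun l s => S.N s l * S.Y s (S.N i k) * S.y l), Finset.mul_sum]
    congr 1
    · refine Finset.sum_congr rfl fun l _ => ?_
      rw [N, S.X_comm_Y]; ring
    · refine Finset.sum_congr rfl fun s _ => ?_
      rw [← mul_assoc, ← S.sum_y_mul_N s, Finset.sum_mul]
      refine Finset.sum_congr rfl fun l _ => ?_
      rw [S.Γ_symm i s k, Γ, N, N]; ring
  simp only [K, sub_mul, Finset.sum_sub_distrib, h1, h2, riem]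
  ring

lemma euler_δ (k : Fin n) (a : A) :
    ∑ m, S.y m * S.Y m (S.δ k a) = S.δ k (∑ m, S.y m * S.Y m a) := by
  simp only [Y_δ, map_sum, Derivation.leibniz, S.δ_y, smul_eq_mul, mul_sub, Finset.sum_sub_distrib,
    Finset.sum_add_distrib, Finset.mul_sum, mul_neg, Finset.sum_neg_distrib]
  rw [Finset.sum_comm (f := fun m l => S.y m * (S.Γ l k m * S.Y l a)), sub_eq_add_neg]
  congr 2
  refine Finset.sum_congr rfl fun l _ => ?_
  rw [← S.sum_y_mul_Γ l k, Finset.mul_sum]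
  exact Finset.sum_congr rfl fun m _ => by ring

lemma euler_K (i k l : Fin n) : ∑ m, S.y m * S.Y m (S.K i k l) = S.K i k l := by
  simp only [K, map_sub, mul_sub, Finset.sum_sub_distrib, euler_δ, euler_N]

lemma Y_N (i j k : Fin n) : S.Y k (S.N i j) = S.Γ i j k := rfl

lemma vertical_bianchi (i k l m : Fin n) :
    S.Y l (S.K i k m) + S.Y k (S.K i m l) + S.Y m (S.K i l k) = 0 := by
  simp only [K, map_sub, Y_δ, Y_N]
  rw [S.Γ_symm i l m, S.Γ_symm i k m, S.Γ_symm i l k]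
  simp only [S.Γ_symm _ l m, S.Γ_symm _ k m, S.Γ_symm _ l k]
  ring

lemma three_mul_K (i k l : Fin n) :
    3 * S.K i k l = S.Y l (S.riem i k) - S.Y k (S.riem i l) := by
  have hY : ∀ k l, S.Y l (S.riem i k) = ∑ m, S.y m * S.Y l (S.K i k m) + S.K i k l := by
    intro k l
    rw [riem_eq, map_sum]
    simp [Derivation.leibniz, S.Y_y, Finset.sum_add_distrib, add_comm]
  have h : ∑ m, S.y m * S.Y l (S.K i k m) - ∑ m, S.y m * S.Y k (S.K i l m) = S.K i k l := by
    rw [← S.euler_K i k l, ← Finset.sum_sub_distrib]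
    refine Finset.sum_congr rfl fun m _ => ?_
    have h := S.vertical_bianchi i k l m
    rw [S.K_antisymm i m l, S.K_antisymm i l k, map_neg, map_neg] at h
    linear_combination S.y m * h
  rw [hY k l, hY l k, S.K_antisymm i l k]
  linear_combination -h

lemma horizontal_bianchi (i k l m : Fin n) :
    S.δ m (S.K i k l) + S.δ k (S.K i l m) + S.δ l (S.K i m k)
      + ∑ s, S.K s m k * S.Γ i l s + ∑ s, S.K s k l * S.Γ i m s
      + ∑ s, S.K s l m * S.Γ i k s = 0 := by
  have h1 := S.δ_comm m k (S.N i l)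
  have h2 := S.δ_comm k l (S.N i m)
  have h3 := S.δ_comm l m (S.N i k)
  simp only [Y_N] at h1 h2 h3
  have hK : ∀ j i k l, S.δ j (S.K i k l) = S.δ j (S.δ k (S.N i l)) - S.δ j (S.δ l (S.N i k)) :=
    fun _ _ _ _ => map_sub _ _ _
  rw [hK, hK, hK]
  linear_combination h1 + h2 + h3

/-- Trace `R^m_{mk}` of the curvature of the nonlinear connection. -/
def trK (k : Fin n) : A := ∑ m, S.K m m k

lemma div_riem (k : Fin n) :
    S.div S.riem k = S.δ k (∑ m, S.riem m m) - ∑ l, S.cov S.trK k l * S.y l := by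
  have hB : ∑ m, ∑ l, S.y l * (S.δ m (S.K m k l) + S.δ k (S.K m l m) + S.δ l (S.K m m k)
      + ∑ s, S.K s m k * S.Γ m l s + ∑ s, S.K s k l * S.Γ m m s
      + ∑ s, S.K s l m * S.Γ m k s) = 0 :=
    Finset.sum_eq_zero fun m _ => Finset.sum_eq_zero fun l _ => by
      rw [S.horizontal_bianchi, mul_zero]
  simp only [mul_add, Finset.sum_add_distrib] at hB
  have e1 : ∑ m, ∑ l, S.y l * S.δ m (S.K m k l)
      = ∑ m, S.δ m (S.riem m k) + ∑ m, ∑ l, S.K m k l * S.N l m := by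
    simp only [riem_eq, map_sum, Derivation.leibniz, S.δ_y, smul_eq_mul, Finset.sum_add_distrib,
      mul_neg, Finset.sum_neg_distrib]
    ring
  have e2 : ∑ m, ∑ l, S.y l * S.δ k (S.K m l m)
      = - S.δ k (∑ m, S.riem m m) - ∑ l, S.trK l * S.N l k := by
    have : ∀ l m, S.K m l m = - S.K m m l := fun l m => S.K_antisymm m l m
    simp only [this]
    simp only [riem_eq, map_sum, Derivation.leibniz, S.δ_y, smul_eq_mul, Finset.sum_add_distrib,
      mul_neg, map_neg, Finset.sum_neg_distrib, trK, Finset.sum_mul]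
    rw [Finset.sum_comm (f := fun l m => S.K m m l * S.N l k)]
    ring
  have e3 : ∑ m, ∑ l, S.y l * S.δ l (S.K m m k) = ∑ l, S.y l * S.δ l (S.trK k) := by
    rw [Finset.sum_comm]
    simp only [trK, map_sum, Finset.mul_sum]
  have e4 : ∑ m, ∑ l, S.y l * ∑ s, S.K s m k * S.Γ m l s
      = - ∑ m, ∑ l, S.K m k l * S.N l m := by
    rw [Finset.sum_comm (f := fun m l => S.K m k l * S.N l m), ← Finset.sum_neg_distrib]
    refine Finset.sum_congr rfl fun m _ => ?_
    simp only [Finset.mul_sum]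
    rw [Finset.sum_comm, ← Finset.sum_neg_distrib]
    refine Finset.sum_congr rfl fun s _ => ?_
    rw [← S.sum_y_mul_Γ m s, Finset.mul_sum, ← Finset.sum_neg_distrib]
    refine Finset.sum_congr rfl fun l _ => ?_
    rw [S.K_antisymm s m k, S.Γ_symm m l s]; ring
  have e5 : ∑ m, ∑ l, S.y l * ∑ s, S.K s k l * S.Γ m m s
      = ∑ m, ∑ l, S.riem l k * S.Γ m l m := by
    refine Finset.sum_congr rfl fun m _ => ?_
    simp only [Finset.mul_sum, riem_eq, Finset.sum_mul]
    rw [Finset.sum_comm]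
    refine Finset.sum_congr rfl fun s _ => Finset.sum_congr rfl fun l _ => ?_
    rw [S.Γ_symm m m s]; ring
  have e6 : ∑ m, ∑ l, S.y l * ∑ s, S.K s l m * S.Γ m k s
      = - ∑ m, ∑ l, S.riem m l * S.Γ l k m := by
    rw [Finset.sum_comm (f := fun m l => S.riem m l * S.Γ l k m), ← Finset.sum_neg_distrib]
    refine Finset.sum_congr rfl fun m _ => ?_
    simp only [Finset.mul_sum, riem_eq, Finset.sum_mul]
    rw [Finset.sum_comm, ← Finset.sum_neg_distrib]
    refine Finset.sum_congr rfl fun s _ => ?_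
    rw [← Finset.sum_neg_distrib]
    refine Finset.sum_congr rfl fun l _ => ?_
    rw [S.K_antisymm s l m]; ring
  have e7 : ∑ l, S.cov S.trK k l * S.y l
      = ∑ l, S.y l * S.δ l (S.trK k) - ∑ l, S.trK l * S.N l k := by
    simp only [cov, sub_mul, Finset.sum_sub_distrib, Finset.sum_mul]
    rw [Finset.sum_comm]
    congr 1
    · exact Finset.sum_congr rfl fun _ _ => mul_comm _ _
    · refine Finset.sum_congr rfl fun s _ => ?_
      rw [← S.sum_y_mul_Γ s k, Finset.mul_sum]
      exact Finset.sum_congr rfl fun l _ => by ring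
  rw [e1, e2, e3, e4, e5, e6] at hB
  simp only [div, Finset.sum_add_distrib, Finset.sum_sub_distrib, e7]
  linear_combination hB

lemma div_add (B C : Fin n → Fin n → A) (k : Fin n) :
    S.div (fun i j => B i j + C i j) k = S.div B k + S.div C k := by
  simp only [div, map_add, add_mul, Finset.sum_add_distrib, Finset.sum_sub_distrib]
  ring

lemma div_smul (c : ℝ) (B : Fin n → Fin n → A) (k : Fin n) :
    S.div (fun i j => c • B i j) k = c • S.div B k := by
  simp only [div, Derivation.map_smul, smul_mul_assoc, ← Finset.smul_sum, ← smul_add, ← smul_sub]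

lemma div_mul_y (B : Fin n → A) (k : Fin n) :
    S.div (fun i j => B j * S.y i) k = ∑ m, S.cov B k m * S.y m := by
  refine Finset.sum_congr rfl fun m _ => ?_
  have h : ∑ l, B k * S.y l * S.Γ m l m = B k * S.N m m := by
    rw [← S.sum_y_mul_Γ m m, Finset.mul_sum]
    exact Finset.sum_congr rfl fun l _ => by rw [S.Γ_symm m l m]; ring
  have h' : ∑ l, B l * S.y m * S.Γ l k m = S.y m * ∑ l, B l * S.Γ l k m := by
    rw [Finset.mul_sum]
    exact Finset.sum_congr rfl fun l _ => by ring
  rw [h, h', Derivation.leibniz, S.δ_y, cov, smul_eq_mul, smul_eq_mul]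
  ring

lemma div_mul_delta (a : A) (k : Fin n) :
    S.div (fun i j => a * if i = j then 1 else 0) k = S.δ k a := by
  have h : ∀ m, S.δ m (a * if m = k then 1 else 0) = if m = k then S.δ m a else 0 := by
    intro m; split_ifs <;> simp
  simp only [div, h]
  simp [S.Γ_symm _ k]

lemma cov_add (B C : Fin n → A) (k m : Fin n) :
    S.cov (fun j => B j + C j) k m = S.cov B k m + S.cov C k m := by
  simp only [cov, map_add, add_mul, Finset.sum_add_distrib]
  ring

lemma cov_smul (c : ℝ) (B : Fin n → A) (k m : Fin n) :
    S.cov (fun j => c • B j) k m = c • S.cov B k m := by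
  simp only [cov, Derivation.map_smul, smul_mul_assoc, ← Finset.smul_sum, ← smul_sub]

/-- Ricci scalar. -/
def ricci : A := ((n : ℝ) - 1)⁻¹ • ∑ m, S.riem m m

/-- The tensor `T^i_k = R^i_k - (R δ^i_k - ½ R_{·k} y^i)`. -/
def T (i k : Fin n) : A :=
  S.riem i k + ((-1 : ℝ) • (S.ricci * if i = k then 1 else 0) +
    (1 / 2 : ℝ) • (S.Y k S.ricci * S.y i))

/-- The χ-curvature. -/
def chi (i : Fin n) : A := (-(1 / 3) : ℝ) • ∑ m, S.Y m (S.T m i)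

/-- The Weyl curvature. -/
def weyl (i k : Fin n) : A := S.T i k + (3 / ((n : ℝ) + 1)) • (S.chi k * S.y i)

lemma euler_riem_trace : ∑ j, S.y j * S.Y j (∑ m, S.riem m m) = 2 * ∑ m, S.riem m m := by
  simp only [map_sum, Finset.mul_sum]
  rw [Finset.sum_comm]
  refine Finset.sum_congr rfl fun i _ => ?_
  simp only [riem_eq, map_sum, Finset.mul_sum]
  rw [Finset.sum_comm]
  refine Finset.sum_congr rfl fun l _ => ?_
  have h := S.euler_K i i l
  simp only [Derivation.leibniz, smul_eq_mul, S.Y_y, mul_add, Finset.sum_add_distrib, mul_ite,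
    mul_one, mul_zero, Finset.sum_ite_eq, Finset.mem_univ, if_true]
  have h' : ∑ j, S.y j * (S.y l * S.Y j (S.K i i l)) = S.y l * S.K i i l := by
    conv_rhs => rw [← h, Finset.mul_sum]
    exact Finset.sum_congr rfl fun j _ => by ring
  rw [h']; ring

lemma euler_Y_ricci (k : Fin n) : ∑ j, S.y j * S.Y j (S.Y k S.ricci) = S.Y k S.ricci := by
  have h : ∑ j, S.y j * S.Y j S.ricci = 2 * S.ricci := by
    simp only [ricci, Derivation.map_smul, mul_smul_comm, ← Finset.smul_sum, euler_riem_trace]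
  rw [S.euler_Y h, S.Y_two_mul]; ring

lemma trace_Y_T (k : Fin n) :
    ∑ m, S.Y m (S.T m k) = ∑ m, S.Y m (S.riem m k) + (((n : ℝ) - 1) / 2) • S.Y k S.ricci := by
  have h1 : ∀ m, S.Y m (S.ricci * if m = k then 1 else 0) = if m = k then S.Y m S.ricci else 0 := by
    intro m; split_ifs <;> simp
  have h2 : ∑ m, S.Y m (S.Y k S.ricci * S.y m) = ((n : ℝ) + 1) • S.Y k S.ricci := by
    simp only [Derivation.leibniz, smul_eq_mul, S.Y_y, if_true, mul_one, Finset.sum_add_distrib,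
      euler_Y_ricci, Finset.sum_const, Finset.card_univ, Fintype.card_fin, add_smul, one_smul,
      Nat.cast_smul_eq_nsmul]
  simp only [T, map_add, Derivation.map_smul, Finset.sum_add_distrib, ← Finset.smul_sum, h1, h2,
    Finset.sum_ite_eq', Finset.mem_univ, if_true]
  module

lemma trK_eq (hn : 2 ≤ n) (k : Fin n) :
    S.trK k = S.chi k + (((n : ℝ) - 1) / 2) • S.Y k S.ricci := by
  have hn' : (n : ℝ) - 1 ≠ 0 := by
    have : (2 : ℝ) ≤ n := by exact_mod_cast hn
    linarith
  have h : (3 : ℝ) • S.trK k = ((n : ℝ) - 1) • S.Y k S.ricci - ∑ m, S.Y m (S.riem m k) := by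
    rw [ricci, Derivation.map_smul, smul_inv_smul₀ hn', map_sum, ← Finset.sum_sub_distrib, trK,
      Finset.smul_sum]
    refine Finset.sum_congr rfl fun m _ => ?_
    rw [← S.three_mul_K, Algebra.smul_def, map_ofNat]
  rw [chi, trace_Y_T]
  linear_combination (norm := module) (1 / 3 : ℝ) • h

/-- The divergence of the Weyl curvature. -/
theorem div_weyl (hn : 2 ≤ n) (k : Fin n) :
    S.div S.weyl k = ((n : ℝ) - 2) • (S.δ k S.ricci
      - (1 / 2 : ℝ) • ∑ m, S.cov (fun j => S.Y j S.ricci) k m * S.y m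
      - (1 / ((n : ℝ) + 1)) • ∑ m, S.cov S.chi k m * S.y m) := by
  have hn2 : (2 : ℝ) ≤ n := by exact_mod_cast hn
  have hn' : (n : ℝ) - 1 ≠ 0 := by linarith
  have hn'' : (n : ℝ) + 1 ≠ 0 := by linarith
  have hP : S.δ k (∑ m, S.riem m m) = ((n : ℝ) - 1) • S.δ k S.ricci := by
    rw [ricci, Derivation.map_smul, smul_inv_smul₀ hn']
  have hW : S.weyl = fun i j => (S.riem i j + ((-1 : ℝ) • (S.ricci * if i = j then 1 else 0) +
      (1 / 2 : ℝ) • (S.Y j S.ricci * S.y i))) + (3 / ((n : ℝ) + 1)) • (S.chi j * S.y i) := rfl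
  have hB : S.trK = fun j => S.chi j + (((n : ℝ) - 1) / 2) • S.Y j S.ricci :=
    funext fun j => S.trK_eq hn j
  rw [hW, div_add, div_add, div_add, div_smul, div_smul, div_smul, div_mul_delta,
    S.div_mul_y (fun j => S.Y j S.ricci), S.div_mul_y S.chi, div_riem, hP, hB]
  simp only [cov_add, cov_smul, add_mul, smul_mul_assoc, Finset.sum_add_distrib,
    ← Finset.smul_sum]
  match_scalars <;> field_simp <;> ring

end SprayAlgebra

section SmoothAlgebra

/-- Extension by zero of a function on a subset. -/
def zeroExt {E : Type*} {Ω : Set E} (f : Ω → ℝ) : E → ℝ := Function.extend Subtype.val f 0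

lemma zeroExt_apply {E : Type*} {Ω : Set E} (f : Ω → ℝ) (p : Ω) : zeroExt f p = f p :=
  Subtype.val_injective.extend_apply f 0 p

lemma zeroExt_eventuallyEq {E : Type*} [TopologicalSpace E] {Ω : Set E} (hΩ : IsOpen Ω)
    {f : Ω → ℝ} {F : E → ℝ} (h : ∀ p : Ω, F p = f p)
    (p : Ω) : zeroExt f =ᶠ[nhds (p : E)] F := by
  filter_upwards [hΩ.mem_nhds p.2] with q hq
  rw [h ⟨q, hq⟩]; exact zeroExt_apply f ⟨q, hq⟩

variable {E : Type*} [NormedAddCommGroup E] [NormedSpace ℝ E]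

lemma contDiffOn_zeroExt {Ω : Set E} {f : Ω → ℝ} {F : E → ℝ} (hF : ContDiffOn ℝ (⊤ : ℕ∞) F Ω)
    (h : ∀ p : Ω, F p = f p) : ContDiffOn ℝ (⊤ : ℕ∞) (zeroExt f) Ω :=
  hF.congr fun p hp => by rw [h ⟨p, hp⟩]; exact zeroExt_apply f ⟨p, hp⟩

/-- The algebra of smooth functions on a subset `Ω` of a normed space. -/
def smoothAlg (Ω : Set E) : Subalgebra ℝ (Ω → ℝ) where
  carrier := {f | ContDiffOn ℝ (⊤ : ℕ∞) (zeroExt f) Ω}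
  mul_mem' hf hg := contDiffOn_zeroExt (hf.mul hg) fun p => by simp [zeroExt_apply]
  add_mem' hf hg := contDiffOn_zeroExt (hf.add hg) fun p => by simp [zeroExt_apply]
  algebraMap_mem' c := contDiffOn_zeroExt (F := fun _ => c) contDiffOn_const fun p => by simp

variable {Ω : Set E}

lemma contDiffAt_zeroExt (hΩ : IsOpen Ω) (f : smoothAlg Ω) (p : Ω) :
    ContDiffAt ℝ (⊤ : ℕ∞) (zeroExt f.1) (p : E) :=
  f.2.contDiffAt (hΩ.mem_nhds p.2)

lemma differentiableAt_zeroExt (hΩ : IsOpen Ω) (f : smoothAlg Ω) (p : Ω) :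
    DifferentiableAt ℝ (zeroExt f.1) (p : E) :=
  (contDiffAt_zeroExt hΩ f p).differentiableAt (by simp)

/-- Directional derivative of a smooth function on an open set. -/
def dirFun (hΩ : IsOpen Ω) (v : E) (f : smoothAlg Ω) : smoothAlg Ω :=
  ⟨fun p => fderiv ℝ (zeroExt f.1) p v,
    contDiffOn_zeroExt (F := fun q => fderiv ℝ (zeroExt f.1) q v)
      ((f.2.fderiv_of_isOpen hΩ (m := (⊤ : ℕ∞)) (by simp)).clm_apply contDiffOn_const)
      fun _ => rfl⟩

lemma dirFun_apply (hΩ : IsOpen Ω) (v : E) (f : smoothAlg Ω) (p : Ω) :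
    (dirFun hΩ v f).1 p = fderiv ℝ (zeroExt f.1) p v := rfl

lemma dirFun_eq (hΩ : IsOpen Ω) (v : E) (f : smoothAlg Ω) (p : Ω) {F : E → ℝ}
    (h : ∀ p : Ω, F p = f.1 p) : (dirFun hΩ v f).1 p = fderiv ℝ F p v := by
  rw [dirFun_apply, (zeroExt_eventuallyEq hΩ h p).fderiv_eq]

/-- Directional derivative as a derivation of the algebra of smooth functions. -/
def dirDeriv (hΩ : IsOpen Ω) (v : E) : Derivation ℝ (smoothAlg Ω) (smoothAlg Ω) :=
  Derivation.mk'
    { toFun := dirFun hΩ v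
      map_add' := fun f g => Subtype.ext <| funext fun p => by
        rw [dirFun_eq hΩ v (f + g) p (F := zeroExt f.1 + zeroExt g.1)
          (fun q => by simp [zeroExt_apply]),
          fderiv_add (differentiableAt_zeroExt hΩ f p) (differentiableAt_zeroExt hΩ g p)]
        rfl
      map_smul' := fun c f => Subtype.ext <| funext fun p => by
        rw [dirFun_eq hΩ v (c • f) p (F := c • zeroExt f.1) (fun q => by simp [zeroExt_apply]),
          fderiv_const_smul (differentiableAt_zeroExt hΩ f p)]
        rfl }
    fun f g => Subtype.ext <| funext fun p => by
      change (dirFun hΩ v (f * g)).1 p = f.1 p * (dirFun hΩ v g).1 p + g.1 p * (dirFun hΩ v f).1 p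
      rw [dirFun_eq hΩ v (f * g) p (F := zeroExt f.1 * zeroExt g.1)
          (fun q => by simp [zeroExt_apply]),
        fderiv_mul (differentiableAt_zeroExt hΩ f p) (differentiableAt_zeroExt hΩ g p)]
      simp [zeroExt_apply, dirFun_apply]

lemma dirDeriv_eq (hΩ : IsOpen Ω) (v : E) (f : smoothAlg Ω) (p : Ω) {F : E → ℝ}
    (h : ∀ p : Ω, F p = f.1 p) : (dirDeriv hΩ v f).1 p = fderiv ℝ F p v :=
  dirFun_eq hΩ v f p h

lemma dirDeriv_comm (hΩ : IsOpen Ω) (v w : E) (f : smoothAlg Ω) :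
    dirDeriv hΩ v (dirDeriv hΩ w f) = dirDeriv hΩ w (dirDeriv hΩ v f) := by
  have key : ∀ (v w : E) (p : Ω), (dirDeriv hΩ v (dirDeriv hΩ w f)).1 p
      = fderiv ℝ (fderiv ℝ (zeroExt f.1)) p v w := by
    intro v w p
    rw [dirDeriv_eq hΩ v (dirDeriv hΩ w f) p (F := fun q => fderiv ℝ (zeroExt f.1) q w)
      (fun _ => rfl)]
    have hd : DifferentiableAt ℝ (fderiv ℝ (zeroExt f.1)) (p : E) :=
      ((contDiffAt_zeroExt hΩ f p).fderiv_right (m := 1) (by norm_cast)).differentiableAt (by simp)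
    rw [fderiv_clm_apply hd (differentiableAt_const w)]
    simp
  refine Subtype.ext <| funext fun p => ?_
  rw [key, key]
  exact ((contDiffAt_zeroExt hΩ f p).isSymmSndFDerivAt (by simp; norm_cast)).eq v w

end SmoothAlgebra

section Representation

variable {n : ℕ} {U : Set (Vec n)}

lemma isOpen_domain (hU : IsOpen U) : IsOpen (U ×ˢ slit n) := hU.prod isOpen_ne

/-- A function of `(x, y)` is represented by the smooth function `a` on `U × (ℝⁿ \ {0})`. -/
def IsRepBy (f : Vec n → Vec n → ℝ) (a : smoothAlg (U ×ˢ slit n)) : Prop :=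
  ∀ p : ↥(U ×ˢ slit n), f p.1.1 p.1.2 = a.1 p

/-- The fibre coordinate `y^i` as a smooth function. -/
def coordY (U : Set (Vec n)) (i : Fin n) : smoothAlg (U ×ˢ slit n) :=
  ⟨fun p => p.1.2 i, contDiffOn_zeroExt (F := fun q : Vec n × Vec n => q.2 i)
    (by fun_prop) fun _ => rfl⟩

lemma IsRepBy.differentiableAt (hU : IsOpen U) {f : Vec n → Vec n → ℝ} {a : smoothAlg (U ×ˢ slit n)}
    (h : IsRepBy f a) (p : ↥(U ×ˢ slit n)) :
    DifferentiableAt ℝ (fun q : Vec n × Vec n => f q.1 q.2) p.1 :=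
  (zeroExt_eventuallyEq (isOpen_domain hU) (F := fun q => f q.1 q.2) h p).differentiableAt_iff.1
    (differentiableAt_zeroExt (isOpen_domain hU) a p)

lemma IsRepBy.pdx (hU : IsOpen U) {f : Vec n → Vec n → ℝ} {a : smoothAlg (U ×ˢ slit n)}
    (h : IsRepBy f a) (i : Fin n) :
    IsRepBy (pdx f i) (dirDeriv (isOpen_domain hU) (Pi.single i 1, 0) a) := by
  intro p
  rw [dirDeriv_eq _ _ a p (F := fun q => f q.1 q.2) h]
  have hd := (h.differentiableAt hU p).hasFDerivAt
  have := hd.comp (f := fun x' => (x', p.1.2)) p.1.1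
    ((hasFDerivAt_id p.1.1).prodMk (hasFDerivAt_const p.1.2 p.1.1))
  exact congrArg (fun L : Vec n →L[ℝ] ℝ => L (Pi.single i 1)) this.fderiv

lemma IsRepBy.pdy (hU : IsOpen U) {f : Vec n → Vec n → ℝ} {a : smoothAlg (U ×ˢ slit n)}
    (h : IsRepBy f a) (i : Fin n) :
    IsRepBy (pdy f i) (dirDeriv (isOpen_domain hU) (0, Pi.single i 1) a) := by
  intro p
  rw [dirDeriv_eq _ _ a p (F := fun q => f q.1 q.2) h]
  have hd := (h.differentiableAt hU p).hasFDerivAt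
  have := hd.comp (f := fun y' => (p.1.1, y')) p.1.2
    ((hasFDerivAt_const p.1.1 p.1.2).prodMk (hasFDerivAt_id p.1.2))
  exact congrArg (fun L : Vec n →L[ℝ] ℝ => L (Pi.single i 1)) this.fderiv

/-- The coefficients of a spray as smooth functions. -/
def sprayCoeff {G : Fin n → Vec n → Vec n → ℝ} (hG : IsSpray U G) (i : Fin n) :
    smoothAlg (U ×ˢ slit n) :=
  ⟨fun p => G i p.1.1 p.1.2, contDiffOn_zeroExt (hG.1 i) fun _ => rfl⟩

lemma rep_sprayCoeff {G : Fin n → Vec n → Vec n → ℝ} (hG : IsSpray U G) (i : Fin n) :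
    IsRepBy (G i) (sprayCoeff hG i) := fun _ => rfl

lemma dirDeriv_coordY (hU : IsOpen U) (v : Vec n × Vec n) (j : Fin n) (p : ↥(U ×ˢ slit n)) :
    (dirDeriv (isOpen_domain hU) v (coordY U j)).1 p = v.2 j := by
  rw [dirDeriv_eq _ _ _ p (F := fun q : Vec n × Vec n => q.2 j) fun _ => rfl]
  have : HasFDerivAt (fun q : Vec n × Vec n => q.2 j)
      ((ContinuousLinearMap.proj j).comp (ContinuousLinearMap.snd ℝ (Vec n) (Vec n))) p.1 :=
    ((ContinuousLinearMap.proj (R := ℝ) (φ := fun _ : Fin n => ℝ) j).comp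
      (ContinuousLinearMap.snd ℝ (Vec n) (Vec n))).hasFDerivAt
  rw [this.fderiv]
  rfl

lemma euler_spray (hU : IsOpen U) {G : Fin n → Vec n → Vec n → ℝ} (hG : IsSpray U G) (i : Fin n)
    (p : ↥(U ×ˢ slit n)) : ∑ j, p.1.2 j * pdy (G i) j p.1.1 p.1.2 = 2 * G i p.1.1 p.1.2 := by
  set x := p.1.1
  set y := p.1.2
  have hy : DifferentiableAt ℝ (fun y' => G i x y') y :=
    ((rep_sprayCoeff hG i).differentiableAt hU p).comp (f := fun y' => (x, y')) y
      ((differentiableAt_const x).prodMk differentiableAt_id)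
  have hlin : ∑ j, y j * pdy (G i) j x y = fderiv ℝ (fun y' => G i x y') y y := by
    have hy' : y = ∑ j, y j • (Pi.single j 1 : Vec n) := by
      simpa using (Finset.univ_sum_single y).symm.trans
        (Finset.sum_congr rfl fun j _ => by rw [← Pi.single_smul, smul_eq_mul, mul_one])
    refine Eq.trans ?_ (congrArg (fderiv ℝ (fun y' => G i x y') y) hy').symm
    simp only [map_sum, map_smul, smul_eq_mul, pdy]
  have h1 : HasDerivAt (fun c : ℝ => G i x (c • y)) (fderiv ℝ (fun y' => G i x y') y y) 1 := by
    have hs : HasDerivAt (fun c : ℝ => c • y) y 1 := by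
      simpa using (hasDerivAt_id (1 : ℝ)).smul_const y
    have hf : HasFDerivAt (fun y' => G i x y') (fderiv ℝ (fun y' => G i x y') y) ((1 : ℝ) • y) := by
      rw [one_smul]; exact hy.hasFDerivAt
    exact hf.comp_hasDerivAt 1 hs
  have h2 : HasDerivAt (fun c : ℝ => G i x (c • y)) (2 * G i x y) 1 := by
    have : HasDerivAt (fun c : ℝ => c ^ 2 * G i x y) (2 * G i x y) 1 := by
      simpa using (hasDerivAt_pow 2 (1 : ℝ)).mul_const (G i x y)
    refine this.congr_of_eventuallyEq ?_
    filter_upwards [lt_mem_nhds (zero_lt_one' ℝ)] with c hc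
    exact hG.2 i x p.2.1 y p.2.2 c hc
  rw [hlin, h1.unique h2]

/-- The algebra of smooth functions on `U × (ℝⁿ \ {0})` with the data of a spray. -/
def sprayAlgebra (hU : IsOpen U) {G : Fin n → Vec n → Vec n → ℝ} (hG : IsSpray U G) :
    SprayAlgebra n (smoothAlg (U ×ˢ slit n)) where
  X i := dirDeriv (isOpen_domain hU) (Pi.single i 1, 0)
  Y i := dirDeriv (isOpen_domain hU) (0, Pi.single i 1)
  y := coordY U
  G := sprayCoeff hG
  X_comm_X _ _ _ := dirDeriv_comm _ _ _ _
  X_comm_Y _ _ _ := dirDeriv_comm _ _ _ _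
  Y_comm_Y _ _ _ := dirDeriv_comm _ _ _ _
  X_y i j := Subtype.ext <| funext fun p => by rw [dirDeriv_coordY hU]; rfl
  Y_y i j := Subtype.ext <| funext fun p => by
    rw [dirDeriv_coordY hU]
    by_cases h : j = i <;> simp [h]
  euler_G i := Subtype.ext <| funext fun p => by
    have h := euler_spray hU hG i p
    have h' : ∀ j, pdy (G i) j p.1.1 p.1.2 = _ := fun j => (rep_sprayCoeff hG i).pdy hU j p
    simp only [h'] at h
    refine Eq.trans ?_ h
    rw [AddSubmonoidClass.coe_finsetSum, Finset.sum_apply]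
    rfl

section Operations

variable {f g : Vec n → Vec n → ℝ} {a b : smoothAlg (U ×ˢ slit n)}

lemma IsRepBy.add (hf : IsRepBy f a) (hg : IsRepBy g b) : IsRepBy (fun x y => f x y + g x y) (a + b) :=
  fun p => congrArg₂ (· + ·) (hf p) (hg p)

lemma IsRepBy.sub (hf : IsRepBy f a) (hg : IsRepBy g b) : IsRepBy (fun x y => f x y - g x y) (a - b) :=
  fun p => congrArg₂ (· - ·) (hf p) (hg p)

lemma IsRepBy.mul (hf : IsRepBy f a) (hg : IsRepBy g b) : IsRepBy (fun x y => f x y * g x y) (a * b) :=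
  fun p => congrArg₂ (· * ·) (hf p) (hg p)

lemma IsRepBy.const_mul (c : ℝ) (hf : IsRepBy f a) : IsRepBy (fun x y => c * f x y) (c • a) :=
  fun p => congrArg (c * ·) (hf p)

lemma IsRepBy.two_mul (hf : IsRepBy f a) : IsRepBy (fun x y => 2 * f x y) (2 * a) :=
  fun p => congrArg ((2 : ℝ) * ·) (hf p)

lemma IsRepBy.sum {f : Fin n → Vec n → Vec n → ℝ} {a : Fin n → smoothAlg (U ×ˢ slit n)}
    (h : ∀ i, IsRepBy (f i) (a i)) : IsRepBy (fun x y => ∑ i, f i x y) (∑ i, a i) := fun p => by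
  simp [h _ p]

lemma IsRepBy.congr (hf : IsRepBy f a) (h : ∀ x y, g x y = f x y) : IsRepBy g a :=
  fun p => (h _ _).trans (hf p)

lemma rep_coordY (i : Fin n) : IsRepBy (U := U) (fun _ y => y i) (coordY U i) := fun _ => rfl

end Operations

variable (hU : IsOpen U) {G : Fin n → Vec n → Vec n → ℝ} (hG : IsSpray U G)

lemma rep_Nc (i j : Fin n) : IsRepBy (Nc G i j) ((sprayAlgebra hU hG).N i j) :=
  (rep_sprayCoeff hG i).pdy hU j

lemma rep_Γc (i j k : Fin n) : IsRepBy (Γc G i j k) ((sprayAlgebra hU hG).Γ i j k) :=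
  (rep_Nc hU hG i j).pdy hU k

lemma rep_hD {f : Vec n → Vec n → ℝ} {a : smoothAlg (U ×ˢ slit n)} (h : IsRepBy f a) (k : Fin n) :
    IsRepBy (hD G f k) ((sprayAlgebra hU hG).δ k a) := by
  rw [SprayAlgebra.δ_apply]
  exact (h.pdx hU k).sub (.sum fun l => (rep_Nc hU hG l k).mul (h.pdy hU l))

lemma rep_covD1 {f : Fin n → Vec n → Vec n → ℝ} {a : Fin n → smoothAlg (U ×ˢ slit n)}
    (h : ∀ i, IsRepBy (f i) (a i)) (k m : Fin n) :
    IsRepBy (covD1 G f k m) ((sprayAlgebra hU hG).cov a k m) :=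
  (rep_hD hU hG (h k) m).sub (.sum fun l => (h l).mul (rep_Γc hU hG l k m))

lemma rep_div {f : Fin n → Fin n → Vec n → Vec n → ℝ}
    {a : Fin n → Fin n → smoothAlg (U ×ˢ slit n)} (h : ∀ i j, IsRepBy (f i j) (a i j)) (k : Fin n) :
    IsRepBy (fun x y => ∑ m, covD11 G f m k m x y) ((sprayAlgebra hU hG).div a k) :=
  .sum fun m => ((rep_hD hU hG (h m k) m).add
    (.sum fun l => (h l k).mul (rep_Γc hU hG m l m))).sub
      (.sum fun l => (h m l).mul (rep_Γc hU hG l k m))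

lemma rep_Riem (i k : Fin n) : IsRepBy (Riem G i k) ((sprayAlgebra hU hG).riem i k) :=
  (((((rep_sprayCoeff hG i).pdx hU k).two_mul).sub
    (.sum fun j => (rep_coordY j).mul (((rep_sprayCoeff hG i).pdx hU j).pdy hU k))).add
    (IsRepBy.two_mul (.sum fun j => (rep_sprayCoeff hG j).mul (rep_Γc hU hG i j k)))).sub
    (.sum fun s => (rep_Nc hU hG i s).mul (rep_Nc hU hG s k))

lemma rep_Ricci : IsRepBy (Ricci G) (sprayAlgebra hU hG).ricci :=
  (IsRepBy.const_mul _ (.sum fun m => rep_Riem hU hG m m)).congr fun x y => by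
    rw [Ricci, div_eq_inv_mul]

lemma rep_delta (i k : Fin n) :
    IsRepBy (U := U) (fun _ _ => if i = k then 1 else 0) (if i = k then 1 else 0) := fun p => by
  split_ifs <;> rfl

lemma rep_Tcurv (i k : Fin n) : IsRepBy (Tcurv G i k) ((sprayAlgebra hU hG).T i k) :=
  ((rep_Riem hU hG i k).add ((((rep_Ricci hU hG).mul (rep_delta i k)).const_mul (-1)).add
    ((((rep_Ricci hU hG).pdy hU k).mul (rep_coordY i)).const_mul (1 / 2)))).congr
    fun x y => by rw [Tcurv]; ring

lemma rep_chiC (i : Fin n) : IsRepBy (chiC G i) ((sprayAlgebra hU hG).chi i) :=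
  IsRepBy.const_mul _ (.sum fun m => (rep_Tcurv hU hG m i).pdy hU m)

lemma rep_Weyl (i k : Fin n) : IsRepBy (Weyl G i k) ((sprayAlgebra hU hG).weyl i k) :=
  ((rep_Tcurv hU hG i k).add (((rep_chiC hU hG k).mul (rep_coordY i)).const_mul _)).congr
    fun x y => by rw [Weyl]; ring

end Representation

/-- Equation (3.11): the divergence of the Weyl curvature satisfies
`W^m_{k|m} = (n-2)(R_{|k} - ½ R_{·k|m} y^m - (1/(n+1)) χ_{k|m} y^m)`. -/
theorem stmt_18 {n : ℕ} (hn : 2 ≤ n) (U : Set (Vec n)) (hU : IsOpen U) (hUne : U.Nonempty)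
    (G : Fin n → Vec n → Vec n → ℝ) (hG : IsSpray U G) :
    ∀ x ∈ U, ∀ y ∈ slit n, ∀ k : Fin n,
      ∑ m, covD11 G (Weyl G) m k m x y =
        ((n : ℝ) - 2) *
          (hD G (Ricci G) k x y
            - (1/2) * ∑ m, covD1 G (fun j => pdy (Ricci G) j) k m x y * y m
            - (1/((n : ℝ) + 1)) * ∑ m, covD1 G (chiC G) k m x y * y m) := by
  intro x hx y hy k
  have hL := rep_div hU hG (rep_Weyl hU hG) k ⟨(x, y), hx, hy⟩
  rw [SprayAlgebra.div_weyl _ hn] at hL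
  have hR := IsRepBy.const_mul ((n : ℝ) - 2) (((rep_hD hU hG (rep_Ricci hU hG) k).sub
    (IsRepBy.const_mul (1 / 2) (.sum fun m => (rep_covD1 hU hG
      (fun j => (rep_Ricci hU hG).pdy hU j) k m).mul (rep_coordY m)))).sub
    (IsRepBy.const_mul (1 / ((n : ℝ) + 1)) (.sum fun m => (rep_covD1 hU hG
      (rep_chiC hU hG) k m).mul (rep_coordY m)))) ⟨(x, y), hx, hy⟩
  exact hL.trans hR.symm

end BerwaldWeyl
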